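/- Let f : [0,1] → ℝ be continuous, let n > 1 be an integer, let x ∈ [0,1], and let c be a real number with -min{x,1-x}/(n-1) ≤ c ≤ 0. Then | Σ_{k=0}^{n} (f(k/n) - f(x)) · p_{n,k}^{x,1-x,c} | ≤ ω(n^{-1/2}) · ( 1 + √n · (F_n^c(x) + F_n^c(1-x)) ). -/

import Mathlib

open scoped BigOperators

/-- The generalized rising factorial `x^{(n,h)} = x(x+h)···(x+(n-1)h)`. -/
noncomputable def risingFac (x h : ℝ) (n : ℕ) : ℝ := ∏ i ∈ Finset.range n, (x + i * h)

/-- The Pólya–Eggenberger probability `p_{n,k}^{a,b,c}`. -/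
noncomputable def polyaP (n k : ℕ) (a b c : ℝ) : ℝ :=
  (n.choose k : ℝ) * risingFac a c k * risingFac b c (n - k) / risingFac (a + b) c n

/-- The largest integer strictly smaller than `nx - √n`, as a natural number. -/
noncomputable def rOf (n : ℕ) (x : ℝ) : ℕ := (⌈(n : ℝ) * x - Real.sqrt n⌉ - 1).toNat

/-- The function `F_n^c`. -/
noncomputable def Fn (n : ℕ) (c x : ℝ) : ℝ :=
  if x ≤ 1 / Real.sqrt n then 0
  else ((n - 1).choose (rOf n x) : ℝ) * risingFac x c (rOf n x + 1) *
      risingFac (1 - x) c (n - rOf n x) / risingFac 1 c n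

/-- The Bernstein-type operator `R_n`. -/
noncomputable def Rop (n : ℕ) (f : ℝ → ℝ) (x : ℝ) : ℝ :=
  ∑ k ∈ Finset.range (n + 1),
    polyaP n k x (1 - x) (-(min x (1 - x)) / (n - 1)) * f (k / n)

/-- The modulus of continuity of `f : [0,1] → ℝ`. -/
noncomputable def modCont (f : ℝ → ℝ) (δ : ℝ) : ℝ :=
  sSup {y : ℝ | ∃ s ∈ Set.Icc (0:ℝ) 1, ∃ t ∈ Set.Icc (0:ℝ) 1, |s - t| ≤ δ ∧ y = |f s - f t|}

lemma risingFac_succ (x h : ℝ) (n : ℕ) :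
    risingFac x h (n + 1) = risingFac x h n * (x + n * h) := by
  simp [risingFac, Finset.prod_range_succ]

/-- Vandermonde's identity for rising factorials with increment `c`. -/
lemma sum_choose_mul_risingFac (a b c : ℝ) (n : ℕ) :
    ∑ k ∈ Finset.range (n + 1), (n.choose k : ℝ) * risingFac a c k * risingFac b c (n - k) =
      risingFac (a + b) c n := by
  rw [← Finset.Nat.sum_antidiagonal_eq_sum_range_succ
    (fun i j => (n.choose i : ℝ) * risingFac a c i * risingFac b c j)]
  induction n with
  | zero => simp [risingFac]
  | succ n ih =>
    have h := Finset.sum_antidiagonal_choose_succ_mul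
      (fun i j => risingFac a c i * risingFac b c j) n
    simp only [← mul_assoc] at h
    rw [h, risingFac_succ, ← ih, ← Finset.sum_add_distrib, Finset.sum_mul]
    refine Finset.sum_congr rfl fun ij hij => ?_
    have hn : (n : ℝ) = ij.1 + ij.2 := by
      exact_mod_cast (Finset.HasAntidiagonal.mem_antidiagonal.1 hij).symm
    rw [risingFac_succ, risingFac_succ, hn,
      Nat.choose_symm_of_eq_add (Finset.HasAntidiagonal.mem_antidiagonal.1 hij).symm]
    ring

/-- The first moments of the lower tail of the Pólya–Eggenberger weights telescope. -/
lemma sum_range_sub_mul_weight (x c : ℝ) (m r : ℕ) (hr : r ≤ m) :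
    ∑ k ∈ Finset.range (r + 1), ((m + 1 : ℕ) * x - k) *
        (((m + 1).choose k : ℝ) * risingFac x c k * risingFac (1 - x) c (m + 1 - k)) =
      (m + 1 : ℕ) *
        ((m.choose r : ℝ) * risingFac x c (r + 1) * risingFac (1 - x) c (m + 1 - r)) := by
  induction r with
  | zero => simp [risingFac]; ring
  | succ r ih =>
    rw [Finset.sum_range_succ, ih (by lia), risingFac_succ x c (r + 1)]
    obtain ⟨j, rfl⟩ := Nat.exists_eq_add_of_le hr
    have e₁ : r + 1 + j + 1 - r = j + 1 + 1 := by lia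
    have e₂ : r + 1 + j + 1 - (r + 1) = j + 1 := by lia
    have h₁ := Nat.add_one_mul_choose_eq (r + 1 + j) r
    have h₂ := Nat.choose_mul_succ_eq (r + 1 + j) (r + 1)
    rw [e₂] at h₂
    rw [e₁, e₂, risingFac_succ (1 - x) c (j + 1)]
    have h₁' : ((r + 1 + j + 1 : ℕ) : ℝ) * ((r + 1 + j).choose r : ℝ) =
      ((r + 1 + j + 1).choose (r + 1) : ℝ) * (r + 1 : ℕ) := by exact_mod_cast h₁
    have h₂' : ((r + 1 + j).choose (r + 1) : ℝ) * (r + 1 + j + 1 : ℕ) =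
      ((r + 1 + j + 1).choose (r + 1) : ℝ) * (j + 1 : ℕ) := by exact_mod_cast h₂
    set A := risingFac x c (r + 1)
    set B := risingFac (1 - x) c (j + 1)
    push_cast at h₁' h₂' ⊢
    linear_combination A * B * (1 - x + (j + 1) * c) * h₁' - A * B * (x + (r + 1) * c) * h₂'

lemma sum_lower_tail_eq_Fn (n : ℕ) (hn : 1 < n) (x c : ℝ) (hx : x ∈ Set.Icc (0 : ℝ) 1) :
    ∑ k ∈ Finset.range (n + 1),
        (if (k : ℝ) / n < x - 1 / √n then (x - k / n) * polyaP n k x (1 - x) c else 0) =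
      Fn n c x := by
  have hn0 : (0 : ℝ) < n := by positivity
  have hs : 0 < √(n : ℝ) := Real.sqrt_pos.2 hn0
  unfold Fn
  split_ifs with h
  · refine Finset.sum_eq_zero fun k _ => if_neg ?_
    have : (0 : ℝ) ≤ k / n := by positivity
    linarith
  · push Not at h
    have hmul : ∀ y : ℝ, n * (y - 1 / √n) = n * y - √n := fun y => by
      have := Real.mul_self_sqrt hn0.le
      field_simp
      nlinarith
    have hpos : 0 < n * x - √n := by
      rw [← hmul]; exact mul_pos hn0 (by linarith)
    have hr : (rOf n x : ℤ) = ⌈(n : ℝ) * x - √n⌉ - 1 := by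
      have := Int.ceil_pos.2 hpos
      exact Int.toNat_of_nonneg (by lia)
    have hk : ∀ k : ℕ, (k : ℝ) / n < x - 1 / √n ↔ k ∈ Finset.range (rOf n x + 1) := fun k => by
      rw [div_lt_iff₀' hn0, hmul, Finset.mem_range, ← Int.cast_natCast k, ← Int.lt_ceil]
      lia
    have hrn : rOf n x < n := by
      have h₁ := (hk (rOf n x)).2 (by simp)
      rw [div_lt_iff₀' hn0, hmul] at h₁
      have : (rOf n x : ℝ) < n := by nlinarith [hx.2]
      exact_mod_cast this
    simp only [hk]
    rw [← Finset.sum_filter, Finset.filter_mem_eq_inter, Finset.inter_eq_right.2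
      (Finset.range_subset_range.2 (by lia))]
    obtain ⟨m, rfl⟩ : ∃ m, n = m + 1 := ⟨n - 1, by lia⟩
    have key := sum_range_sub_mul_weight x c m (rOf (m + 1) x) (by lia)
    rw [Nat.add_sub_cancel, eq_div_of_mul_eq hn0.ne' ((mul_comm _ _).trans key.symm),
      div_div, Finset.sum_div]
    refine Finset.sum_congr rfl fun k _ => ?_
    rw [polyaP, add_sub_cancel, ← div_div, mul_div_right_comm (_ - _), sub_div,
      mul_div_cancel_left₀ _ hn0.ne', mul_div_assoc (x - _)]

lemma polyaP_symm (n k : ℕ) (hk : k ≤ n) (a b c : ℝ) :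
    polyaP n (n - k) a b c = polyaP n k b a c := by
  rw [polyaP, polyaP, Nat.choose_symm hk, Nat.sub_sub_self hk, add_comm a b]
  ring

lemma sum_upper_tail_eq_Fn (n : ℕ) (hn : 1 < n) (x c : ℝ) (hx : x ∈ Set.Icc (0 : ℝ) 1) :
    ∑ k ∈ Finset.range (n + 1),
        (if x + 1 / √n < (k : ℝ) / n then (k / n - x) * polyaP n k x (1 - x) c else 0) =
      Fn n c (1 - x) := by
  have hn0 : (n : ℝ) ≠ 0 := by positivity
  rw [← sum_lower_tail_eq_Fn n hn (1 - x) c ⟨by linarith [hx.2], by linarith [hx.1]⟩,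
    ← Finset.sum_range_reflect]
  refine Finset.sum_congr rfl fun k hk => ?_
  have hk' : k ≤ n := Nat.lt_succ_iff.1 (Finset.mem_range.1 hk)
  rw [Nat.add_sub_cancel, polyaP_symm n k hk', Nat.cast_sub hk', sub_div, div_self hn0,
    sub_sub_cancel]
  congr 1
  · exact propext ⟨fun h => by linarith, fun h => by linarith⟩
  · ring

lemma risingFac_nonneg (a c : ℝ) (n : ℕ) (h : ∀ i < n, 0 ≤ a + i * c) : 0 ≤ risingFac a c n :=
  Finset.prod_nonneg fun i hi => h i (Finset.mem_range.1 hi)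

lemma risingFac_pos (a c : ℝ) (n : ℕ) (h : ∀ i < n, 0 < a + i * c) : 0 < risingFac a c n :=
  Finset.prod_pos fun i hi => h i (Finset.mem_range.1 hi)

lemma abs_sub_le_modCont (f : ℝ → ℝ) (hf : ContinuousOn f (Set.Icc (0 : ℝ) 1)) {δ s t : ℝ}
    (hs : s ∈ Set.Icc (0 : ℝ) 1) (ht : t ∈ Set.Icc (0 : ℝ) 1) (hst : |s - t| ≤ δ) :
    |f s - f t| ≤ modCont f δ := by
  obtain ⟨C, hC⟩ := isCompact_Icc.exists_bound_of_continuousOn hf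
  refine le_csSup ⟨C + C, ?_⟩ ⟨s, hs, t, ht, hst, rfl⟩
  rintro _ ⟨u, hu, v, hv, -, rfl⟩
  exact (abs_sub _ _).trans (add_le_add (hC u hu) (hC v hv))

lemma modCont_nonneg (f : ℝ → ℝ) (δ : ℝ) : 0 ≤ modCont f δ := by
  refine Real.sSup_nonneg ?_
  rintro _ ⟨u, -, v, -, -, rfl⟩
  exact abs_nonneg _

lemma abs_sub_le_nat_mul_modCont (f : ℝ → ℝ) (hf : ContinuousOn f (Set.Icc (0 : ℝ) 1)) {δ : ℝ}
    (m : ℕ) {s t : ℝ} (hs : s ∈ Set.Icc (0 : ℝ) 1) (ht : t ∈ Set.Icc (0 : ℝ) 1)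
    (hst : |s - t| ≤ m * δ) : |f s - f t| ≤ m * modCont f δ := by
  induction m generalizing s with
  | zero =>
    have : s = t := by
      simpa [sub_eq_zero] using hst
    simp [this]
  | succ m ih =>
    have hm : (0 : ℝ) < m + 1 := by positivity
    push_cast at hst ⊢
    set z := t + m / (m + 1) * (s - t) with hz
    have hsz : s - z = (s - t) / (m + 1) := by rw [hz]; field_simp; ring
    have hzt : z - t = m * ((s - t) / (m + 1)) := by rw [hz]; field_simp; ring
    have hδ : |(s - t) / (m + 1)| ≤ δ := by
      rwa [abs_div, abs_of_pos hm, div_le_iff₀' hm]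
    have hmem : z ∈ Set.Icc (0 : ℝ) 1 :=
      (convex_Icc (0 : ℝ) 1).add_smul_sub_mem ht hs
        ⟨by positivity, (div_le_one hm).2 (by linarith)⟩
    have h₁ := abs_sub_le_modCont f hf hs hmem (hsz ▸ hδ)
    have h₂ := ih hmem (by
      rw [hzt, abs_mul, Nat.abs_cast]
      exact mul_le_mul_of_nonneg_left hδ (Nat.cast_nonneg m))
    linarith [abs_sub_le (f s) (f z) (f t)]

lemma abs_sub_le_one_add_div_mul_modCont (f : ℝ → ℝ) (hf : ContinuousOn f (Set.Icc (0 : ℝ) 1))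
    {δ s t : ℝ} (hδ : 0 < δ) (hs : s ∈ Set.Icc (0 : ℝ) 1) (ht : t ∈ Set.Icc (0 : ℝ) 1) :
    |f s - f t| ≤ modCont f δ * (1 + |s - t| / δ) := by
  have h := abs_sub_le_nat_mul_modCont f hf (δ := δ) ⌈|s - t| / δ⌉₊ hs ht
    ((div_le_iff₀ hδ).1 (Nat.le_ceil _))
  have hceil := (Nat.ceil_lt_add_one (show 0 ≤ |s - t| / δ by positivity)).le
  nlinarith [mul_le_mul_of_nonneg_right hceil (modCont_nonneg f δ)]

theorem abs_sum_le_modCont (f : ℝ → ℝ) (hf : ContinuousOn f (Set.Icc (0:ℝ) 1))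
    (n : ℕ) (hn : 1 < n) (x : ℝ) (hx : x ∈ Set.Icc (0:ℝ) 1)
    (c : ℝ) (hc₁ : -(min x (1 - x)) / (n - 1) ≤ c) (hc₂ : c ≤ 0) :
    |∑ k ∈ Finset.range (n + 1), (f (k / n) - f x) * polyaP n k x (1 - x) c| ≤
      modCont f (1 / Real.sqrt n) * (1 + Real.sqrt n * (Fn n c x + Fn n c (1 - x))) := by
  have hn0 : (0 : ℝ) < n := by positivity
  have hs : 0 < √(n : ℝ) := Real.sqrt_pos.2 hn0
  have hn1 : (0 : ℝ) < n - 1 := by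
    have : (1 : ℝ) < n := by exact_mod_cast hn
    linarith
  have hstep : ∀ i < n, -(min x (1 - x)) ≤ i * c := fun i hi => by
    rw [div_le_iff₀ hn1] at hc₁
    have : (i : ℝ) + 1 ≤ n := by exact_mod_cast hi
    nlinarith
  have hposx : ∀ i < n, 0 ≤ x + i * c := fun i hi => by
    linarith [hstep i hi, min_le_left x (1 - x)]
  have hposy : ∀ i < n, 0 ≤ 1 - x + i * c := fun i hi => by
    linarith [hstep i hi, min_le_right x (1 - x)]
  have hD : 0 < risingFac (x + (1 - x)) c n := risingFac_pos _ _ _ fun i hi => by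
    linarith [hstep i hi, min_le_right x (1 - x), min_le_left x (1 - x)]
  have hp : ∀ k ∈ Finset.range (n + 1), 0 ≤ polyaP n k x (1 - x) c := fun k hk => by
    have hk := Finset.mem_range.1 hk
    have h₁ := risingFac_nonneg x c k fun i hi => hposx i (by lia)
    have h₂ := risingFac_nonneg (1 - x) c (n - k) fun i hi => hposy i (by lia)
    unfold polyaP
    positivity
  have hsum : ∑ k ∈ Finset.range (n + 1), polyaP n k x (1 - x) c = 1 := by
    unfold polyaP
    rw [← Finset.sum_div, sum_choose_mul_risingFac, div_self hD.ne']
  have hrhs : 1 + √n * (Fn n c x + Fn n c (1 - x)) = ∑ k ∈ Finset.range (n + 1),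
      (polyaP n k x (1 - x) c + √n *
        ((if (k : ℝ) / n < x - 1 / √n then (x - k / n) * polyaP n k x (1 - x) c else 0) +
          if x + 1 / √n < (k : ℝ) / n then (k / n - x) * polyaP n k x (1 - x) c else 0)) := by
    rw [Finset.sum_add_distrib, hsum, ← Finset.mul_sum, Finset.sum_add_distrib,
      sum_lower_tail_eq_Fn n hn x c hx, sum_upper_tail_eq_Fn n hn x c hx]
  rw [hrhs, Finset.mul_sum]
  refine (Finset.abs_sum_le_sum_abs _ _).trans (Finset.sum_le_sum fun k hk => ?_)
  have hpk := hp k hk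
  have hkn : (k : ℝ) / n ∈ Set.Icc (0 : ℝ) 1 := by
    refine ⟨by positivity, (div_le_one hn0).2 ?_⟩
    exact_mod_cast Nat.lt_succ_iff.1 (Finset.mem_range.1 hk)
  have hδ : 0 < 1 / √(n : ℝ) := by positivity
  have hfar := abs_sub_le_one_add_div_mul_modCont f hf hδ hkn hx
  rw [div_div_eq_mul_div, div_one] at hfar
  have hfar' := mul_le_mul_of_nonneg_right hfar hpk
  rw [abs_mul, abs_of_nonneg hpk]
  split_ifs with h₁ h₂ h₂
  · linarith
  · rw [abs_of_neg (show (k : ℝ) / n - x < 0 by linarith)] at hfar'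
    linarith
  · rw [abs_of_pos (show 0 < (k : ℝ) / n - x by linarith)] at hfar'
    linarith
  · have hnear := abs_sub_le_modCont f hf hkn hx (δ := 1 / √n)
      (abs_le.2 ⟨by linarith, by linarith⟩)
    simpa using mul_le_mul_of_nonneg_right hnear hpk
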